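/- Let w_1, w_2 ∈ ℂ be not both zero and let c ∈ ℝ. Then there exist x ∈ ℝ and z ∈ ℂ such that i(x + c) w_1 + z w_2 = 0 and −z̄ w_1 + i(−x + c) w_2 = 0. -/

import Mathlib

/-- For `(w₁, w₂) ∈ ℂ²` not both zero and `c ∈ ℝ`, there exist `x ∈ ℝ` and
`z ∈ ℂ` with `i(x+c)w₁ + z w₂ = 0` and `-z̄ w₁ + i(-x+c)w₂ = 0`. -/
theorem stmt9 (w₁ w₂ : ℂ) (hw : ¬(w₁ = 0 ∧ w₂ = 0)) (c : ℝ) :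
    ∃ (x : ℝ) (z : ℂ),
      Complex.I * ((x : ℂ) + (c : ℂ)) * w₁ + z * w₂ = 0 ∧
      -(starRingEnd ℂ z) * w₁ + Complex.I * (-(x : ℂ) + (c : ℂ)) * w₂ = 0 := by
  have hN : Complex.normSq w₁ + Complex.normSq w₂ ≠ 0 := by
    intro h
    have h1 := Complex.normSq_nonneg w₁
    have h2 := Complex.normSq_nonneg w₂
    exact hw ⟨Complex.normSq_eq_zero.mp (by linarith), Complex.normSq_eq_zero.mp (by linarith)⟩
  have hN' : w₁ * starRingEnd ℂ w₁ + w₂ * starRingEnd ℂ w₂ ≠ 0 := by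
    rw [Complex.mul_conj, Complex.mul_conj]
    exact_mod_cast hN
  refine ⟨c * (Complex.normSq w₂ - Complex.normSq w₁) / (Complex.normSq w₁ + Complex.normSq w₂),
    -2 * Complex.I * c * w₁ * starRingEnd ℂ w₂ /
      (w₁ * starRingEnd ℂ w₁ + w₂ * starRingEnd ℂ w₂), ?_, ?_⟩
  · push_cast
    rw [← Complex.mul_conj, ← Complex.mul_conj]
    field_simp
    ring
  · simp only [map_div₀, map_mul, map_add, map_neg, Complex.conj_I, Complex.conj_conj,
      Complex.conj_ofReal, map_ofNat]
    push_cast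
    rw [← Complex.mul_conj, ← Complex.mul_conj, mul_comm (starRingEnd ℂ w₁) w₁,
      mul_comm (starRingEnd ℂ w₂) w₂]
    generalize starRingEnd ℂ w₁ = a at *
    generalize starRingEnd ℂ w₂ = b at *
    obtain ⟨N, hNd⟩ : ∃ N, N = w₁ * a + w₂ * b := ⟨_, rfl⟩
    rw [← hNd] at hN' ⊢
    field_simp
    rw [hNd]
    ring
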